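/- arXiv:1906.11813 — 2 statements merged into one kernel-verified Lean document; each statement's English description precedes it below -/
import Mathlib

section
/- Let (Ω, ℱ, P) be a probability space, X : Ω → R^p and ε : Ω → R^l be measurable random vectors with X and ε independent, g : R^p → R^m measurable, Z := g(X), and Y := h(X) an integrable real-valued random variable for measurable h : R^p → R. Let S := f(Z, ε) for a measurable f : R^m × R^l → R with E|S| < ∞ and E|SY| < ∞. Then Cov(S, Y) = Cov(S, E[Y | σ(Z)]). -/
open MeasureTheory ProbabilityTheory

/-- If `X` and `ε` are independent, then adjoining `ε` to `g ∘ X` does not change the conditional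
expectation of a function of `X`. -/
theorem condExp_comap_prodMk_ae_eq_of_indepFun
    {Ω α β γ : Type*} {mΩ : MeasurableSpace Ω} [MeasurableSpace α] [mβ : MeasurableSpace β]
    [mγ : MeasurableSpace γ] {P : Measure Ω} [IsProbabilityMeasure P]
    {X : Ω → α} {ε : Ω → β} (hX : Measurable X) (hε : Measurable ε) (hIndep : IndepFun X ε P)
    {g : α → γ} (hg : Measurable g) {h : α → ℝ} (hh : Measurable h)
    (hInt : Integrable (fun ω => h (X ω)) P) :
    P[(fun ω => h (X ω)) | mγ.comap (fun ω => g (X ω))] =ᵐ[P]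
      P[(fun ω => h (X ω)) | (mγ.prod mβ).comap (fun ω => (g (X ω), ε ω))] := by
  have hZ : Measurable fun ω => g (X ω) := hg.comp hX
  have hZε : Measurable fun ω => (g (X ω), ε ω) := hZ.prodMk hε
  obtain ⟨k, hk, hk_eq⟩ :=
    (stronglyMeasurable_condExp (μ := P) (f := fun ω => h (X ω))
      (m := mγ.comap (fun ω => g (X ω)))).measurable.exists_eq_measurable_comp
  have hkInt : Integrable (fun ω => k (g (X ω))) P := by
    have := integrable_condExp (μ := P) (f := fun ω => h (X ω))
      (m := mγ.comap (fun ω => g (X ω)))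
    rwa [hk_eq] at this
  have hw : Measurable fun x => k (g x) - h x := (hk.comp hg).sub hh
  have hwInt : Integrable (fun ω => k (g (X ω)) - h (X ω)) P := hkInt.sub hInt
  have h_zero : ∀ A : Set γ, MeasurableSet A →
      ∫ ω in (fun ω => g (X ω)) ⁻¹' A, (k (g (X ω)) - h (X ω)) ∂P = 0 := by
    intro A hA
    rw [integral_sub hkInt.integrableOn hInt.integrableOn, sub_eq_zero,
      ← setIntegral_condExp hZ.comap_le hInt ⟨A, hA, rfl⟩, hk_eq]
    rfl
  refine ae_eq_condExp_of_forall_setIntegral_eq hZε.comap_le hInt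
    (fun _ _ _ => integrable_condExp.integrableOn) ?_ ?_
  · rintro _ ⟨D, hD, rfl⟩ -
    rw [hk_eq, ← sub_eq_zero]
    change ∫ ω in _, k (g (X ω)) ∂P - _ = 0
    rw [← integral_sub hkInt.integrableOn hInt.integrableOn, ← integral_indicator (hZε hD)]
    let F : α × β → ℝ :=
      ((fun q : α × β => (g q.1, q.2)) ⁻¹' D).indicator fun q => k (g q.1) - h q.1
    have hgm : Measurable fun q : α × β => (g q.1, q.2) :=
      (hg.comp measurable_fst).prodMk measurable_snd
    have hF : Measurable F := (hw.comp measurable_fst).indicator (hgm hD)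
    have hmap := hIndep.map_prod_eq_prod_map_map hX.aemeasurable hε.aemeasurable
    have hXε : Measurable fun ω => (X ω, ε ω) := hX.prodMk hε
    have hFInt : Integrable F ((P.map X).prod (P.map ε)) := by
      rw [← hmap, integrable_map_measure hF.aestronglyMeasurable hXε.aemeasurable]
      exact hwInt.indicator (hZε hD)
    calc
      _ = ∫ q, F q ∂(P.map fun ω => (X ω, ε ω)) :=
        (integral_map hXε.aemeasurable hF.aestronglyMeasurable).symm
      _ = ∫ e, ∫ x, F (x, e) ∂(P.map X) ∂(P.map ε) := by
        rw [hmap, integral_prod_symm F hFInt]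
      _ = ∫ _, 0 ∂(P.map ε) := by
        refine integral_congr_ae (.of_forall fun e => ?_)
        have hA : MeasurableSet ((fun z => (z, e)) ⁻¹' D) := measurable_prodMk_right hD
        dsimp only
        have hFe : Measurable fun x => F (x, e) := hF.comp measurable_prodMk_right
        rw [integral_map hX.aemeasurable hFe.aestronglyMeasurable, ← h_zero _ hA,
          ← integral_indicator (hZ hA)]
        rfl
      _ = 0 := integral_zero _ _
  · have hle : mγ.comap (fun ω => g (X ω)) ≤
        (mγ.prod mβ).comap (fun ω => (g (X ω), ε ω)) := by
      rintro _ ⟨A, hA, rfl⟩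
      exact ⟨Prod.fst ⁻¹' A, measurable_fst hA, rfl⟩
    exact (stronglyMeasurable_condExp.mono hle).aestronglyMeasurable



/-- If `X ⟂ ε`, `Z = g(X)`, `Y = h(X)` and `S = f(Z, ε)`, then
`Cov(S, Y) = Cov(S, E[Y | σ(Z)])`. -/
theorem cov_eq_cov_condexp
    {Ω : Type*} [mΩ : MeasurableSpace Ω] (P : Measure Ω) [IsProbabilityMeasure P]
    {p l m : ℕ}
    (X : Ω → Fin p → ℝ) (ε : Ω → Fin l → ℝ)
    (hX : Measurable X) (hε : Measurable ε)
    (hIndep : IndepFun X ε P)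
    (g : (Fin p → ℝ) → Fin m → ℝ) (hg : Measurable g)
    (h : (Fin p → ℝ) → ℝ) (hh : Measurable h)
    (hYInt : Integrable (fun ω => h (X ω)) P)
    (f : (Fin m → ℝ) → (Fin l → ℝ) → ℝ) (hf : Measurable (Function.uncurry f))
    (S : Ω → ℝ) (hS : ∀ ω, S ω = f (g (X ω)) (ε ω))
    (hSInt : Integrable S P)
    (hSYInt : Integrable (fun ω => S ω * h (X ω)) P) :
    (∫ ω, S ω * h (X ω) ∂P) - (∫ ω, S ω ∂P) * (∫ ω, h (X ω) ∂P)
      = (∫ ω, S ω * (P[(fun ω' => h (X ω')) |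
            MeasurableSpace.comap (fun ω' => g (X ω')) inferInstance]) ω ∂P)
        - (∫ ω, S ω ∂P) *
            (∫ ω, (P[(fun ω' => h (X ω')) |
              MeasurableSpace.comap (fun ω' => g (X ω')) inferInstance]) ω ∂P) := by
  have hZ : Measurable fun ω => g (X ω) := hg.comp hX
  have hZε : Measurable fun ω => (g (X ω), ε ω) := hZ.prodMk hε
  have hSm : StronglyMeasurable[
      MeasurableSpace.comap (fun ω => (g (X ω), ε ω)) inferInstance] S := by
    rw [show S = Function.uncurry f ∘ fun ω => (g (X ω), ε ω) from funext hS]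
    exact (hf.comp (comap_measurable _)).stronglyMeasurable
  have hpull := condExp_mul_of_stronglyMeasurable_left hSm hSYInt hYInt
  have hcond := condExp_comap_prodMk_ae_eq_of_indepFun hX hε hIndep hg hh hYInt
  rw [integral_condExp hZ.comap_le, ← integral_condExp hZε.comap_le]
  congr 1
  refine integral_congr_ae ?_
  filter_upwards [hpull, hcond] with ω h₁ h₂
  rw [h₂]
  exact h₁
end

section
/- Let H be a real Hilbert space, d ≤ r natural numbers, and let e_1,…,e_r and u_1,…,u_d be orthonormal families in H such that ⟨e_i, u_j⟩ = σ_i if i = j ≤ d and 0 otherwise, where σ_1,…,σ_d ∈ [0,1]. Fix ε ∈ [0,1] and set, for i = 1,…,d, γ_i := max{σ_i, ε}, ρ_i := √((1−γ_i²)/(1−σ_i²)) if σ_i < 1 and ρ_i := 0 if σ_i = 1, and ξ_i := (γ_i − ρ_i σ_i) e_i + ρ_i u_i. Then the family ξ_1,…,ξ_d is orthonormal: ⟨ξ_i, ξ_j⟩ = 1 if i = j and 0 otherwise. -/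
open scoped RealInnerProductSpace

/-- Squared norm of `(g - r * s) • e + r • u` for unit vectors `e`, `u` with `⟪e, u⟫ = s`. -/
theorem inner_self_sub_mul_smul_add_smul {H : Type*} [NormedAddCommGroup H]
    [InnerProductSpace ℝ H] {e u : H} {g r s : ℝ} (he : ⟪e, e⟫ = 1) (hu : ⟪u, u⟫ = 1)
    (heu : ⟪e, u⟫ = s) :
    ⟪(g - r * s) • e + r • u, (g - r * s) • e + r • u⟫ = g ^ 2 + r ^ 2 * (1 - s ^ 2) := by
  have hue : ⟪u, e⟫ = s := by rw [real_inner_comm, heu]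
  simp only [inner_add_left, inner_add_right, real_inner_smul_left, real_inner_smul_right,
    he, hu, heu, hue]
  ring

/-- The weight `√((1 - g²) / (1 - s²))`, set to `0` at `s = 1`, satisfies its defining relation
for `g = max s ε`. -/
theorem sq_ite_sqrt_div_mul {s ε : ℝ} (hs0 : 0 ≤ s) (hs1 : s ≤ 1) (hε1 : ε ≤ 1) :
    (if s = 1 then 0 else √((1 - max s ε ^ 2) / (1 - s ^ 2))) ^ 2 * (1 - s ^ 2) =
      1 - max s ε ^ 2 := by
  split_ifs with h
  · simp [h, max_eq_left hε1]
  · have hs : 0 < 1 - s ^ 2 := by nlinarith [lt_of_le_of_ne hs1 h]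
    have hg0 : 0 ≤ max s ε := le_max_of_le_left hs0
    have hg : 0 ≤ 1 - max s ε ^ 2 := by nlinarith [max_le hs1 hε1]
    rw [Real.sq_sqrt (div_nonneg hg hs.le), div_mul_cancel₀ _ hs.ne']

/-- The family ξ_i = (γ_i − ρ_i σ_i) e_i + ρ_i u_i is orthonormal. -/
theorem xi_orthonormal
    {H : Type*} [NormedAddCommGroup H] [InnerProductSpace ℝ H]
    {d r : ℕ} (hdr : d ≤ r)
    (e : Fin r → H) (u : Fin d → H)
    (he : Orthonormal ℝ e) (hu : Orthonormal ℝ u)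
    (σ : Fin d → ℝ) (hσ0 : ∀ i, 0 ≤ σ i) (hσ1 : ∀ i, σ i ≤ 1)
    (hcross : ∀ (i : Fin r) (j : Fin d),
      ⟪e i, u j⟫ = if (i : ℕ) = (j : ℕ) then σ j else 0)
    (ε : ℝ) (hε0 : 0 ≤ ε) (hε1 : ε ≤ 1)
    (γ ρ : Fin d → ℝ) (ξ : Fin d → H)
    (hγ : ∀ i, γ i = max (σ i) ε)
    (hρ : ∀ i, ρ i = if σ i = 1 then 0
      else Real.sqrt ((1 - γ i ^ 2) / (1 - σ i ^ 2)))
    (hξ : ∀ i, ξ i = (γ i - ρ i * σ i) • e (Fin.castLE hdr i) + ρ i • u i) :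
    ∀ i j : Fin d, ⟪ξ i, ξ j⟫ = if i = j then 1 else 0 := by
  intro i j
  split_ifs with hij
  · subst hij
    have hσ : ⟪e (Fin.castLE hdr i), u i⟫ = σ i := by simp [hcross]
    rw [hξ, inner_self_sub_mul_smul_add_smul (by simp [he.1]) (by simp [hu.1]) hσ, hρ, hγ,
      sq_ite_sqrt_div_mul (hσ0 i) (hσ1 i) hε1]
    ring
  · have hval : (i : ℕ) ≠ j := Fin.val_ne_of_ne hij
    have hee : ⟪e (Fin.castLE hdr i), e (Fin.castLE hdr j)⟫ = 0 :=
      he.2 fun h => hij (Fin.castLE_injective hdr h)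
    have heu : ⟪e (Fin.castLE hdr i), u j⟫ = 0 := by simp [hcross, hval]
    have hue : ⟪u i, e (Fin.castLE hdr j)⟫ = 0 := by
      rw [real_inner_comm]
      simp [hcross, hval.symm]
    simp [hξ, inner_add_left, inner_add_right, real_inner_smul_left, real_inner_smul_right,
      hee, heu, hue, hu.2 hij]
end
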